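/- arXiv:0908.0953 — 4 statements merged into one kernel-verified Lean document; each statement's English description precedes it below -/
import Mathlib

section
/- (Lemma 1, algebraic form.) Let y, k ∈ ℝ³ with self-dual matrices Y, K, let g be an invertible real 4×4 matrix, and set D := ½ g⁻¹ [Y, K] g. If y × k ≠ 0, then D is invertible and its inverse is proportional to D itself: D⁻¹ = −(16/|y × k|²) D. -/
noncomputable section
open Matrix BigOperators

/-- The so(4) generator `T_{ab}` with entries `(T_{ab})^I_J = δ_a^I δ_{bJ} − δ_{aJ} δ_b^I`. -/
def Tgen (a b : Fin 4) : Matrix (Fin 4) (Fin 4) ℝ :=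
  Matrix.of fun I J =>
    (if I = a then (1:ℝ) else 0) * (if J = b then (1:ℝ) else 0)
      - (if J = a then (1:ℝ) else 0) * (if I = b then (1:ℝ) else 0)

/-- The three-dimensional Levi-Civita symbol. -/
def eps3 (a b c : Fin 3) : ℝ :=
  ((((b:ℤ) - (a:ℤ)) * ((c:ℤ) - (a:ℤ)) * ((c:ℤ) - (b:ℤ)) : ℤ) : ℝ) / 2

/-- The self-dual generators `T_{+a} = ½(T_{0a} + ½ Σ ε_{abc} T_{bc})`, `a = 1,2,3`. -/
def Tplus (a : Fin 3) : Matrix (Fin 4) (Fin 4) ℝ :=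
  (1/2 : ℝ) • (Tgen 0 a.succ
    + (1/2 : ℝ) • ∑ b : Fin 3, ∑ c : Fin 3, eps3 a b c • Tgen b.succ c.succ)

/-- The self-dual matrix `Σ_a u^a T_{+a}` of a vector `u ∈ ℝ³`. -/
def sd (u : Fin 3 → ℝ) : Matrix (Fin 4) (Fin 4) ℝ := ∑ a : Fin 3, u a • Tplus a

/-- The cross product on ℝ³. -/
def cross (u v : Fin 3 → ℝ) : Fin 3 → ℝ :=
  ![u 1 * v 2 - u 2 * v 1, u 2 * v 0 - u 0 * v 2, u 0 * v 1 - u 1 * v 0]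


theorem sd_eq (u : Fin 3 → ℝ) :
    sd u = !![0, u 0 / 2, u 1 / 2, u 2 / 2; -(u 0 / 2), 0, u 2 / 2, -(u 1 / 2);
      -(u 1 / 2), -(u 2 / 2), 0, u 0 / 2; -(u 2 / 2), u 1 / 2, -(u 0 / 2), 0] := by
  ext i j
  simp only [sd, Tplus, Tgen, eps3, Fin.sum_univ_three, Matrix.add_apply, Matrix.smul_apply,
    smul_eq_mul, Matrix.of_apply]
  fin_cases i <;> fin_cases j <;> simp [-Fin.val_eq_zero_iff] <;> ring

set_option maxHeartbeats 1000000 in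
theorem sd_commutator (u v : Fin 3 → ℝ) :
    sd u * sd v - sd v * sd u = -sd (cross u v) := by
  rw [sd_eq u, sd_eq v, sd_eq (cross u v)]
  ext i j
  fin_cases i <;> fin_cases j <;> simp [cross] <;> ring

set_option maxHeartbeats 1000000 in
theorem sd_mul_self (w : Fin 3 → ℝ) :
    sd w * sd w = (-(∑ a : Fin 3, (w a)^2) / 4) • (1 : Matrix (Fin 4) (Fin 4) ℝ) := by
  rw [sd_eq, Fin.sum_univ_three]
  ext i j
  fin_cases i <;> fin_cases j <;> simp <;> ring

theorem sum_sq_ne_zero {w : Fin 3 → ℝ} (hw : w ≠ 0) : ∑ a : Fin 3, (w a)^2 ≠ 0 := by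
  contrapose! hw
  rw [Finset.sum_eq_zero_iff_of_nonneg fun a _ => sq_nonneg (w a)] at hw
  ext a
  simpa using hw a (Finset.mem_univ a)

/-- Lemma 1, algebraic form: `D = ½ g⁻¹[Y,K]g` is invertible with inverse
proportional to itself, `D⁻¹ = −(16/|y × k|²) D`, whenever `y × k ≠ 0`. -/
theorem dirac_matrix_inverse (y k : Fin 3 → ℝ) (g : Matrix (Fin 4) (Fin 4) ℝ)
    (hg : IsUnit g) (D : Matrix (Fin 4) (Fin 4) ℝ)
    (hD : D = (1/2 : ℝ) • (g⁻¹ * (sd y * sd k - sd k * sd y) * g))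
    (hyk : cross y k ≠ 0) :
    IsUnit D ∧ D⁻¹ = (-(16 / ∑ a : Fin 3, (cross y k a)^2)) • D := by
  have hs := sum_sq_ne_zero hyk
  have hdet : IsUnit g.det := (Matrix.isUnit_iff_isUnit_det g).mp hg
  have hsq : D * D = (-(∑ a : Fin 3, (cross y k a)^2) / 16) • 1 := by
    have hC : (sd y * sd k - sd k * sd y) * (sd y * sd k - sd k * sd y)
        = (-(∑ a : Fin 3, (cross y k a)^2) / 4) • 1 := by
      rw [sd_commutator, neg_mul_neg, sd_mul_self]
    set C := sd y * sd k - sd k * sd y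
    have hconj : (g⁻¹ * C * g) * (g⁻¹ * C * g) = g⁻¹ * (C * C) * g := by
      simp only [Matrix.mul_assoc, Matrix.mul_nonsing_inv_cancel_left g _ hdet]
    rw [hD, Matrix.smul_mul, Matrix.mul_smul, hconj, hC, Matrix.mul_smul, Matrix.smul_mul,
      Matrix.mul_one, Matrix.nonsing_inv_mul g hdet, smul_smul, smul_smul]
    congr 1
    ring
  have hinv : D * ((-(16 / ∑ a : Fin 3, (cross y k a)^2)) • D) = 1 := by
    rw [Matrix.mul_smul, hsq, smul_smul]
    convert one_smul ℝ (1 : Matrix (Fin 4) (Fin 4) ℝ) using 2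
    field_simp
  exact ⟨IsUnit.of_mul_eq_one _ hinv, Matrix.inv_eq_right_inv hinv⟩

end
end

section
/- (Centraliser of a non-degenerate simple bivector.) Let u, v ∈ ℝ⁴ be linearly independent and let B be the antisymmetric matrix with entries B_{IJ} = u_I v_J − u_J v_I. Then every antisymmetric real 4×4 matrix M commuting with B (i.e. MB = BM) is of the form M = α B + β ⋆B for some real numbers α, β; that is, the centraliser of B inside the antisymmetric matrices is the two-dimensional span of B and ⋆B. -/
noncomputable section
open Matrix BigOperators

/-- The four-dimensional Levi-Civita symbol with `ε_{0123} = 1`. -/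
def eps4 (I J K L : Fin 4) : ℝ :=
  ((((J:ℤ) - (I:ℤ)) * ((K:ℤ) - (I:ℤ)) * ((L:ℤ) - (I:ℤ)) * ((K:ℤ) - (J:ℤ))
      * ((L:ℤ) - (J:ℤ)) * ((L:ℤ) - (K:ℤ)) : ℤ) : ℝ) / 12

/-- The Hodge star `(⋆X)_{IJ} = ½ Σ_{K,L} ε_{IJKL} X_{KL}`. -/
def hodge (X : Matrix (Fin 4) (Fin 4) ℝ) : Matrix (Fin 4) (Fin 4) ℝ :=
  Matrix.of fun I J => (1/2 : ℝ) * ∑ K : Fin 4, ∑ L : Fin 4, eps4 I J K L * X K L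

/-- The simple bivector `B_{IJ} = u_I v_J − u_J v_I` of `u, v ∈ ℝ⁴`. -/
def bivec (u v : Fin 4 → ℝ) : Matrix (Fin 4) (Fin 4) ℝ :=
  Matrix.of fun I J => u I * v J - u J * v I


/-- The antisymmetric 4×4 matrix with prescribed entries above the diagonal. -/
def skew4 (a b c d e f : ℝ) : Matrix (Fin 4) (Fin 4) ℝ :=
  !![0, a, b, c; -a, 0, d, e; -b, -d, 0, f; -c, -e, -f, 0]

lemma eq_skew4_of_transpose_eq_neg {M : Matrix (Fin 4) (Fin 4) ℝ} (hM : Mᵀ = -M) :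
    M = skew4 (M 0 1) (M 0 2) (M 0 3) (M 1 2) (M 1 3) (M 2 3) := by
  have h : ∀ i j, M j i = -M i j := fun i j => congrFun₂ hM i j
  have h0 : ∀ i, M i i = 0 := fun i => by linarith [h i i]
  ext i j
  fin_cases i <;> fin_cases j <;> simp [skew4, h0] <;> exact h _ _

lemma hodge_skew4 (a b c d e f : ℝ) :
    hodge (skew4 a b c d e f) = skew4 f (-e) d c (-b) a := by
  ext i j
  fin_cases i <;> fin_cases j <;>
    simp [hodge, skew4, eps4, Fin.sum_univ_four] <;> ring

lemma bivec_eq_skew4 (u v : Fin 4 → ℝ) :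
    bivec u v = skew4 (u 0 * v 1 - u 1 * v 0) (u 0 * v 2 - u 2 * v 0) (u 0 * v 3 - u 3 * v 0)
      (u 1 * v 2 - u 2 * v 1) (u 1 * v 3 - u 3 * v 1) (u 2 * v 3 - u 3 * v 2) := by
  ext i j
  fin_cases i <;> fin_cases j <;> simp [bivec, skew4]

/-- An antisymmetric matrix commuting with an antisymmetric matrix of zero Pfaffian is, up to the
squared norm of the latter, a combination of it and its Hodge dual. -/
lemma smul_skew4_eq_of_commute {a b c d e f p q r s t w : ℝ}
    (hpf : a * f - b * e + c * d = 0)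
    (hcomm : skew4 p q r s t w * skew4 a b c d e f = skew4 a b c d e f * skew4 p q r s t w) :
    (a ^ 2 + b ^ 2 + c ^ 2 + d ^ 2 + e ^ 2 + f ^ 2) • skew4 p q r s t w =
      (a * p + b * q + c * r + d * s + e * t + f * w) • skew4 a b c d e f +
      (f * p - e * q + d * r + c * s - b * t + a * w) • hodge (skew4 a b c d e f) := by
  have h := congrFun₂ hcomm
  have h01 := h 0 1
  have h02 := h 0 2
  have h03 := h 0 3
  have h12 := h 1 2
  have h13 := h 1 3
  have h23 := h 2 3
  simp [skew4, Matrix.mul_apply, Fin.sum_univ_four] at h01 h02 h03 h12 h13 h23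
  rw [hodge_skew4]
  ext i j
  fin_cases i <;> fin_cases j <;> simp [skew4] <;> grind

lemma sum_sq_minors_ne_zero {u v : Fin 4 → ℝ} (huv : LinearIndependent ℝ ![u, v]) :
    (u 0 * v 1 - u 1 * v 0) ^ 2 + (u 0 * v 2 - u 2 * v 0) ^ 2 + (u 0 * v 3 - u 3 * v 0) ^ 2 +
      (u 1 * v 2 - u 2 * v 1) ^ 2 + (u 1 * v 3 - u 3 * v 1) ^ 2 +
      (u 2 * v 3 - u 3 * v 2) ^ 2 ≠ 0 := by
  intro h
  rw [LinearIndependent.pair_iff] at huv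
  have h01 : u 0 * v 1 - u 1 * v 0 = 0 := by rw [← sq_eq_zero_iff]; nlinarith
  have h02 : u 0 * v 2 - u 2 * v 0 = 0 := by rw [← sq_eq_zero_iff]; nlinarith
  have h03 : u 0 * v 3 - u 3 * v 0 = 0 := by rw [← sq_eq_zero_iff]; nlinarith
  have h12 : u 1 * v 2 - u 2 * v 1 = 0 := by rw [← sq_eq_zero_iff]; nlinarith
  have h13 : u 1 * v 3 - u 3 * v 1 = 0 := by rw [← sq_eq_zero_iff]; nlinarith
  have h23 : u 2 * v 3 - u 3 * v 2 = 0 := by rw [← sq_eq_zero_iff]; nlinarith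
  have hu : u = 0 := by
    ext j
    have := (huv (v j) (-u j) (by
      ext i
      fin_cases i <;> fin_cases j <;> simp <;> linarith)).2
    simpa using this
  simpa using (huv 1 0 (by simp [hu])).1

/-- the centraliser of a non-degenerate simple bivector `B` inside the
antisymmetric 4×4 matrices is the span of `B` and `⋆B`. -/
theorem centraliser_of_simple_bivector (u v : Fin 4 → ℝ)
    (huv : LinearIndependent ℝ ![u, v]) (M : Matrix (Fin 4) (Fin 4) ℝ)
    (hM : Mᵀ = -M) (hcomm : M * bivec u v = bivec u v * M) :
    ∃ α β : ℝ, M = α • bivec u v + β • hodge (bivec u v) := by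
  have hN := sum_sq_minors_ne_zero huv
  rw [eq_skew4_of_transpose_eq_neg hM, bivec_eq_skew4] at hcomm ⊢
  have h := smul_skew4_eq_of_commute (by ring) hcomm
  rw [← eq_inv_smul_iff₀ hN, smul_add, smul_smul, smul_smul] at h
  exact ⟨_, _, h⟩

end
end

section
/- Let u, v ∈ ℝ⁴ be linearly independent, let B be the antisymmetric matrix with entries B_{IJ} = u_I v_J − u_J v_I, and let M = α B + β ⋆B for real numbers α ≥ β ≥ 0. Setting τ² := ⟨M, M⟩ and s² := (M, M), one has τ² = (α² + β²)⟨B, B⟩ and s² = 2αβ⟨B, B⟩; consequently τ² + s² ≥ 0, τ² − s² ≥ 0, and α = (√(τ² + s²) + √(τ² − s²)) / (2√⟨B, B⟩), β = (√(τ² + s²) − √(τ² − s²)) / (2√⟨B, B⟩). -/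
noncomputable section
open Matrix BigOperators

/-- The bilinear form `⟨X,Y⟩ = −½ Tr(XY)`. -/
def kform (X Y : Matrix (Fin 4) (Fin 4) ℝ) : ℝ := -(1/2 : ℝ) * Matrix.trace (X * Y)

/-- The bilinear form `(X,Y) = ¼ Σ ε_{IJKL} X_{IJ} Y_{KL}`. -/
def sform (X Y : Matrix (Fin 4) (Fin 4) ℝ) : ℝ :=
  (1/4 : ℝ) * ∑ I : Fin 4, ∑ J : Fin 4, ∑ K : Fin 4, ∑ L : Fin 4,
    eps4 I J K L * X I J * Y K L

set_option maxHeartbeats 1000000 in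
/-- The six independent components of the Hodge dual. -/
theorem hodge_eq (X : Matrix (Fin 4) (Fin 4) ℝ) (hX : Xᵀ = -X) :
    hodge X = !![0, X 2 3, -X 1 3, X 1 2;
                 -X 2 3, 0, X 0 3, -X 0 2;
                 X 1 3, -X 0 3, 0, X 0 1;
                 -X 1 2, X 0 2, -X 0 1, 0] := by
  have h : ∀ I J, X J I = -X I J := fun I J => congrFun (congrFun hX I) J
  ext I J
  fin_cases I <;> fin_cases J <;>
    norm_num [hodge, eps4, Fin.sum_univ_four, h 0 1, h 0 2, h 0 3, h 1 2, h 1 3, h 2 3] <;> ring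

theorem transpose_hodge (X : Matrix (Fin 4) (Fin 4) ℝ) (hX : Xᵀ = -X) :
    (hodge X)ᵀ = -hodge X := by
  rw [hodge_eq X hX]
  ext I J
  fin_cases I <;> fin_cases J <;> simp

theorem hodge_hodge (X : Matrix (Fin 4) (Fin 4) ℝ) (hX : Xᵀ = -X) : hodge (hodge X) = X := by
  have h : ∀ I J, X J I = -X I J := fun I J => congrFun (congrFun hX I) J
  have h₀ : ∀ I, X I I = 0 := fun I => by linarith [h I I]
  rw [hodge_eq _ (transpose_hodge X hX), hodge_eq X hX]
  ext I J
  fin_cases I <;> fin_cases J <;> simp [h₀, h 0 1, h 0 2, h 0 3, h 1 2, h 1 3, h 2 3]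

theorem hodge_smul_add_smul (a b : ℝ) (X Y : Matrix (Fin 4) (Fin 4) ℝ) :
    hodge (a • X + b • Y) = a • hodge X + b • hodge Y := by
  ext I J
  simp only [hodge, of_apply, Matrix.add_apply, Matrix.smul_apply, smul_eq_mul, mul_add,
    Finset.sum_add_distrib, Finset.mul_sum]
  congr 1 <;> refine Finset.sum_congr rfl fun K _ => Finset.sum_congr rfl fun L _ => by ring

theorem kform_comm (X Y : Matrix (Fin 4) (Fin 4) ℝ) : kform X Y = kform Y X := by
  rw [kform, kform, trace_mul_comm]

theorem kform_smul_add_smul (a b c d : ℝ) (X Y Z W : Matrix (Fin 4) (Fin 4) ℝ) :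
    kform (a • X + b • Y) (c • Z + d • W) =
      a * c * kform X Z + a * d * kform X W + b * c * kform Y Z + b * d * kform Y W := by
  simp only [kform, add_mul, mul_add, smul_mul_assoc, mul_smul_comm, trace_add, trace_smul,
    smul_eq_mul]
  ring

theorem kform_eq_sum (X Y : Matrix (Fin 4) (Fin 4) ℝ) (hX : Xᵀ = -X) :
    kform X Y = (1/2 : ℝ) * ∑ I, ∑ J, X I J * Y I J := by
  have h : ∀ I J, X J I = -X I J := fun I J => congrFun (congrFun hX I) J
  rw [kform, trace, Finset.sum_comm]
  simp only [diag_apply, mul_apply]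
  rw [neg_mul, ← mul_neg, ← Finset.sum_neg_distrib]
  congr 1
  refine Finset.sum_congr rfl fun J _ => ?_
  rw [← Finset.sum_neg_distrib]
  exact Finset.sum_congr rfl fun I _ => by rw [h I J, neg_mul, neg_neg]

theorem sform_eq_kform_hodge (X Y : Matrix (Fin 4) (Fin 4) ℝ) (hX : Xᵀ = -X) :
    sform X Y = kform X (hodge Y) := by
  simp only [kform_eq_sum X _ hX, sform, hodge, of_apply, Finset.mul_sum]
  refine Finset.sum_congr rfl fun I _ => Finset.sum_congr rfl fun J _ =>
    Finset.sum_congr rfl fun K _ => Finset.sum_congr rfl fun L _ => by ring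

theorem kform_hodge_hodge (X : Matrix (Fin 4) (Fin 4) ℝ) (hX : Xᵀ = -X) :
    kform (hodge X) (hodge X) = kform X X := by
  have h : ∀ I J, X J I = -X I J := fun I J => congrFun (congrFun hX I) J
  have h₀ : ∀ I, X I I = 0 := fun I => by linarith [h I I]
  rw [kform_eq_sum _ _ (transpose_hodge X hX), kform_eq_sum X _ hX, hodge_eq X hX]
  simp [Fin.sum_univ_four, h₀, h 0 1, h 0 2, h 0 3, h 1 2, h 1 3, h 2 3]
  ring

theorem transpose_bivec (u v : Fin 4 → ℝ) : (bivec u v)ᵀ = -bivec u v := by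
  ext I J
  simp [bivec]

theorem kform_bivec_hodge_bivec (u v : Fin 4 → ℝ) :
    kform (bivec u v) (hodge (bivec u v)) = 0 := by
  rw [kform_eq_sum _ _ (transpose_bivec u v), hodge_eq _ (transpose_bivec u v)]
  simp [Fin.sum_univ_four, bivec]
  ring

theorem kform_bivec_pos (u v : Fin 4 → ℝ) (huv : LinearIndependent ℝ ![u, v]) :
    0 < kform (bivec u v) (bivec u v) := by
  rw [kform_eq_sum _ _ (transpose_bivec u v)]
  have hnonneg : ∀ I J, 0 ≤ bivec u v I J * bivec u v I J := fun I J => mul_self_nonneg _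
  refine mul_pos (by norm_num) ((Finset.sum_nonneg fun I _ =>
    Finset.sum_nonneg fun J _ => hnonneg I J).lt_of_ne' fun h => ?_)
  have hB : ∀ I J, u I * v J = u J * v I := by
    intro I J
    have hI := (Finset.sum_eq_zero_iff_of_nonneg
      fun I _ => Finset.sum_nonneg fun J _ => hnonneg I J).1 h I (Finset.mem_univ I)
    have hIJ := (Finset.sum_eq_zero_iff_of_nonneg fun J _ => hnonneg I J).1 hI J
      (Finset.mem_univ J)
    exact sub_eq_zero.1 (mul_self_eq_zero.1 hIJ)
  rw [LinearIndependent.pair_iff] at huv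
  have hu : ∀ I, u I = 0 := fun I => by
    have := (huv (v I) (-u I) (by ext J; simp; linarith [hB I J])).2
    linarith
  exact one_ne_zero (huv 1 0 (by ext J; simp [hu])).1

/-- invariants of `M = αB + β⋆B` and recovery of `α`, `β` from the
invariants `τ² = ⟨M,M⟩`, `s² = (M,M)`. -/
theorem invariants_determine_coefficients (u v : Fin 4 → ℝ)
    (huv : LinearIndependent ℝ ![u, v]) (α β : ℝ) (hβ : 0 ≤ β) (hαβ : β ≤ α)
    (M : Matrix (Fin 4) (Fin 4) ℝ)
    (hM : M = α • bivec u v + β • hodge (bivec u v))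
    (τ2 s2 : ℝ) (hτ : τ2 = kform M M) (hs : s2 = sform M M) :
    τ2 = (α^2 + β^2) * kform (bivec u v) (bivec u v) ∧
    s2 = 2 * α * β * kform (bivec u v) (bivec u v) ∧
    0 ≤ τ2 + s2 ∧ 0 ≤ τ2 - s2 ∧
    α = (Real.sqrt (τ2 + s2) + Real.sqrt (τ2 - s2))
          / (2 * Real.sqrt (kform (bivec u v) (bivec u v))) ∧
    β = (Real.sqrt (τ2 + s2) - Real.sqrt (τ2 - s2))
          / (2 * Real.sqrt (kform (bivec u v) (bivec u v))) := by
  have hB := transpose_bivec u v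
  have hpos := kform_bivec_pos u v huv
  have hMt : Mᵀ = -M := by
    rw [hM, transpose_add, transpose_smul, transpose_smul, hB, transpose_hodge _ hB]
    simp [add_comm]
  have hτ' : τ2 = (α^2 + β^2) * kform (bivec u v) (bivec u v) := by
    rw [hτ, hM, kform_smul_add_smul, kform_comm (hodge _) (bivec u v),
      kform_bivec_hodge_bivec, kform_hodge_hodge _ hB]
    ring
  have hs' : s2 = 2 * α * β * kform (bivec u v) (bivec u v) := by
    rw [hs, sform_eq_kform_hodge _ _ hMt, hM, hodge_smul_add_smul, hodge_hodge _ hB,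
      kform_smul_add_smul, kform_comm (hodge _) (bivec u v),
      kform_bivec_hodge_bivec, kform_hodge_hodge _ hB]
    ring
  generalize kform (bivec u v) (bivec u v) = k at *
  have hadd : τ2 + s2 = (α + β)^2 * k := by rw [hτ', hs']; ring
  have hsub : τ2 - s2 = (α - β)^2 * k := by rw [hτ', hs']; ring
  have hk : Real.sqrt k ≠ 0 := (Real.sqrt_pos.2 hpos).ne'
  refine ⟨hτ', hs', by rw [hadd]; positivity, by rw [hsub]; positivity, ?_, ?_⟩ <;>
    rw [hadd, hsub, Real.sqrt_mul (sq_nonneg _), Real.sqrt_mul (sq_nonneg _),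
      Real.sqrt_sq (by linarith), Real.sqrt_sq (by linarith)] <;>
    field_simp <;> ring

end
end

section
/- (Hamilton equations reproduce the wave equation.) Let α′ > 0 and set v := πα′. Let X : ℝ² → ℝ⁴ be twice continuously differentiable and M : ℝ² → M₄(ℝ) be continuously differentiable, such that for all (t, x): M(t,x)² = −(1/(2πα′)²)·1 (where 1 is the 4×4 identity matrix), ∂ₜX = 2v M ∂ₓX, and ∂ₜM = v[∂ₓM, M], where [A,B] = AB − BA. Then X satisfies the Euclidean wave equation: ∂ₜ²X + ∂ₓ²X = 0. -/
noncomputable section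
open Matrix BigOperators


/-- Product rule for a matrix acting on a vector, with the matrix differentiated entrywise. -/
lemma HasDerivAt.matrix_mulVec {m n : Type*} [Fintype m] [Fintype n] {A : ℝ → Matrix m n ℝ}
    {A' : Matrix m n ℝ} {u : ℝ → n → ℝ} {u' : n → ℝ} {t : ℝ}
    (hA : ∀ i j, HasDerivAt (fun s => A s i j) (A' i j) t) (hu : HasDerivAt u u' t) :
    HasDerivAt (fun s => A s *ᵥ u s) (A' *ᵥ u t + A t *ᵥ u') t := by
  rw [hasDerivAt_pi] at hu ⊢
  intro i
  simp only [Matrix.mulVec, dotProduct, Pi.add_apply, ← Finset.sum_add_distrib]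
  exact HasDerivAt.fun_sum fun j _ => (hA i j).mul (hu j)

/-- Product rule for matrices differentiated entrywise. -/
lemma HasDerivAt.matrix_mul_apply {l m n : Type*} [Fintype m] {A : ℝ → Matrix l m ℝ}
    {B : ℝ → Matrix m n ℝ} {A' : Matrix l m ℝ} {B' : Matrix m n ℝ} {t : ℝ}
    (hA : ∀ i j, HasDerivAt (fun s => A s i j) (A' i j) t)
    (hB : ∀ i j, HasDerivAt (fun s => B s i j) (B' i j) t) (i : l) (k : n) :
    HasDerivAt (fun s => (A s * B s) i k) ((A' * B t + A t * B') i k) t := by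
  simp only [Matrix.mul_apply, Matrix.add_apply, ← Finset.sum_add_distrib]
  exact HasDerivAt.fun_sum fun j _ => (hA i j).mul (hB j k)

/-- A differentiable matrix function whose square is constant anticommutes with its derivative. -/
lemma Matrix.anticommute_deriv_of_mul_self_eq_const {n : Type*} [Fintype n]
    {A : ℝ → Matrix n n ℝ} {A' C : Matrix n n ℝ} {t : ℝ}
    (hA : ∀ i j, HasDerivAt (fun s => A s i j) (A' i j) t) (hC : ∀ s, A s * A s = C) :
    A' * A t + A t * A' = 0 := by
  ext i j
  have h := HasDerivAt.matrix_mul_apply hA hA i j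
  simp only [hC] at h
  exact h.unique (hasDerivAt_const t (C i j))

section PartialDerivatives

variable {E : Type*} [NormedAddCommGroup E] [NormedSpace ℝ E]

lemma HasFDerivAt.hasDerivAt_fst {f : ℝ × ℝ → E} {f' : ℝ × ℝ →L[ℝ] E} {t x : ℝ}
    (hf : HasFDerivAt f f' (t, x)) : HasDerivAt (fun s => f (s, x)) (f' (1, 0)) t :=
  hf.comp_hasDerivAt (f := fun s : ℝ => (s, x)) t
    ((hasDerivAt_id t).prodMk (hasDerivAt_const t x))

lemma HasFDerivAt.hasDerivAt_snd {f : ℝ × ℝ → E} {f' : ℝ × ℝ →L[ℝ] E} {t x : ℝ}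
    (hf : HasFDerivAt f f' (t, x)) : HasDerivAt (fun y => f (t, y)) (f' (0, 1)) x :=
  hf.comp_hasDerivAt (f := fun y : ℝ => (t, y)) x
    ((hasDerivAt_const x t).prodMk (hasDerivAt_id x))

/-- The mixed second partial derivatives of a `C²` function exist and agree. -/
lemma ContDiff.hasDerivAt_deriv_snd_fst {f : ℝ × ℝ → E} (hf : ContDiff ℝ 2 f) (t x : ℝ) :
    HasDerivAt (fun s => deriv (fun y => f (s, y)) x)
      (deriv (fun y => deriv (fun s => f (s, y)) t) x) t := by
  have hd : Differentiable ℝ f := hf.differentiable (by norm_num)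
  have hd2 : Differentiable ℝ (fderiv ℝ f) :=
    (hf.fderiv_right (m := 1) (by norm_num)).differentiable (by norm_num)
  have hfst : ∀ t x, deriv (fun s => f (s, x)) t = fderiv ℝ f (t, x) (1, 0) :=
    fun t x => (hd (t, x)).hasFDerivAt.hasDerivAt_fst.deriv
  have hsnd : ∀ t x, deriv (fun y => f (t, y)) x = fderiv ℝ f (t, x) (0, 1) :=
    fun t x => (hd (t, x)).hasFDerivAt.hasDerivAt_snd.deriv
  have hsymm : IsSymmSndFDerivAt ℝ f (t, x) :=
    hf.contDiffAt.isSymmSndFDerivAt (by simp)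
  have h := (hd2 (t, x)).hasFDerivAt
  simp only [hfst, hsnd]
  rw [(h.hasDerivAt_snd.clm_apply (hasDerivAt_const x ((1 : ℝ), (0 : ℝ)))).deriv]
  convert h.hasDerivAt_fst.clm_apply (hasDerivAt_const t ((0 : ℝ), (1 : ℝ))) using 1
  simpa using hsymm.eq (0, 1) (1, 0)

/-- The second argument of a `C²` function can be differentiated twice. -/
lemma ContDiff.hasDerivAt_deriv_snd_snd {f : ℝ × ℝ → E} (hf : ContDiff ℝ 2 f) (t x : ℝ) :
    HasDerivAt (fun y => deriv (fun y' => f (t, y')) y)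
      (deriv (fun y => deriv (fun y' => f (t, y')) y) x) x := by
  have hg : ContDiff ℝ 2 (fun y => f (t, y)) := hf.comp (contDiff_const.prodMk contDiff_id)
  exact ((hg.iterate_deriv' 1 1).differentiable (by norm_num) x).hasDerivAt

end PartialDerivatives

/-- Hamilton equations reproduce the wave equation: if
`M² = −(1/(2πα′)²)·1`, `∂ₜX = 2v M ∂ₓX` and `∂ₜM = v[∂ₓM, M]` with `v = πα′`, then
`∂ₜ²X + ∂ₓ²X = 0`. -/
theorem hamilton_equations_give_wave_equation (α' : ℝ) (hα : 0 < α')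
    (v : ℝ) (hv : v = Real.pi * α')
    (X : ℝ → ℝ → Fin 4 → ℝ) (M : ℝ → ℝ → Matrix (Fin 4) (Fin 4) ℝ)
    (hX : ContDiff ℝ 2 (fun p : ℝ × ℝ => X p.1 p.2))
    (hM : ∀ I J, ContDiff ℝ 1 (fun p : ℝ × ℝ => M p.1 p.2 I J))
    (hM2 : ∀ t x, M t x * M t x
      = (-(1 / (2 * Real.pi * α')^2)) • (1 : Matrix (Fin 4) (Fin 4) ℝ))
    (h1 : ∀ t x, deriv (fun s => X s x) t
      = (2 * v) • (M t x).mulVec (deriv (fun y => X t y) x))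
    (h2 : ∀ t x I J, deriv (fun s => M s x I J) t
      = v * ((Matrix.of (fun I' J' => deriv (fun y => M t y I' J') x) * M t x
          - M t x * Matrix.of (fun I' J' => deriv (fun y => M t y I' J') x)) I J)) :
    ∀ t x, deriv (fun s => deriv (fun s' => X s' x) s) t
         + deriv (fun y => deriv (fun y' => X t y') y) x = 0 := by
  intro t x
  set Mx : Matrix (Fin 4) (Fin 4) ℝ :=
    Matrix.of fun I J => deriv (fun y => M t y I J) x
  set Xd : Fin 4 → ℝ := deriv (fun y => X t y) x with hXd
  set Xxx : Fin 4 → ℝ := deriv (fun y => deriv (fun y' => X t y') y) x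
  have hMd : ∀ I J, HasFDerivAt (fun p : ℝ × ℝ => M p.1 p.2 I J) _ (t, x) := fun I J =>
    ((hM I J).differentiable (by norm_num) (t, x)).hasFDerivAt
  have hM_x : ∀ I J, HasDerivAt (fun y => M t y I J) (Mx I J) x := fun I J =>
    (hMd I J).hasDerivAt_snd.differentiableAt.hasDerivAt
  have hMt : ∀ I J, HasDerivAt (fun s => M s x I J) ((v • (Mx * M t x - M t x * Mx)) I J) t := by
    intro I J
    have h := (hMd I J).hasDerivAt_fst.differentiableAt.hasDerivAt
    rwa [h2 t x I J] at h
  have hanti : Mx * M t x + M t x * Mx = 0 :=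
    Matrix.anticommute_deriv_of_mul_self_eq_const hM_x (hM2 t)
  have hXtx := hX.hasDerivAt_deriv_snd_fst t x
  have hXx : HasDerivAt (fun y => deriv (fun s => X s y) t)
      ((2 * v) • (Mx *ᵥ Xd + M t x *ᵥ Xxx)) x := by
    simp only [h1]
    exact (HasDerivAt.matrix_mulVec hM_x (hX.hasDerivAt_deriv_snd_snd t x)).const_smul (2 * v)
  simp only [hXx.deriv] at hXtx
  have hXtt := (HasDerivAt.matrix_mulVec hMt hXtx).fun_const_smul (2 * v)
  have hscal : 4 * v ^ 2 * (1 / (2 * Real.pi * α') ^ 2) = 1 := by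
    rw [hv]
    have := Real.pi_pos
    field_simp
    norm_num
  have hMM : M t x *ᵥ (M t x *ᵥ Xxx) = -(1 / (2 * Real.pi * α') ^ 2) • Xxx := by
    rw [Matrix.mulVec_mulVec, hM2, Matrix.smul_mulVec, Matrix.one_mulVec]
  have hcomm : Mx *ᵥ (M t x *ᵥ Xd) = -(M t x *ᵥ (Mx *ᵥ Xd)) := by
    rw [Matrix.mulVec_mulVec, Matrix.mulVec_mulVec, eq_neg_of_add_eq_zero_left hanti,
      Matrix.neg_mulVec]
  have hfun : (fun s => deriv (fun s' => X s' x) s)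
      = fun s => (2 * v) • (M s x *ᵥ deriv (fun y => X s y) x) := funext fun s => h1 s x
  rw [hfun, hXtt.deriv, Matrix.smul_mulVec, Matrix.sub_mulVec, Matrix.mulVec_smul,
    Matrix.mulVec_add, hMM, ← Matrix.mulVec_mulVec, ← Matrix.mulVec_mulVec, ← hXd, hcomm]
  ext I
  simp only [Pi.add_apply, Pi.smul_apply, Pi.sub_apply, Pi.neg_apply, Pi.zero_apply, smul_eq_mul]
  linear_combination -Xxx I * hscal

end
end
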